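/- Let (F_1,…,F_m;k) be an instance of the sMaf problem, and let F* be a soft maximum agreement forest for its X-forests. Let v be a vertex of F_i (1 ≤ i ≤ m) with children c_1,…,c_p,c_{p+1},…,c_q (2 ≤ p < q), and let F_i' be the X-forest obtained from F_i by expanding the children subset {c_1,…,c_p} of v. If for every label l ∈ L(c_1) ∪ … ∪ L(c_p) and every label l' ∈ L(c_{p+1}) ∪ … ∪ L(c_q) there is no path between l and l' in F*, then F* is also a soft maximum agreement forest for the X-forests in (F_1,…,F_i',…,F_m;k). -/

import Mathlib

/-!
A formalization framework for the Maximum Agreement Forest problem on multiple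
rooted multifurcating phylogenetic trees.

An `X`-forest is modeled (up to forced contraction and label-preserving
isomorphism) by the laminar family of the label-sets `L(v)` of its vertices:
every vertex `v` is identified with the set `L(v)` of labels at its leaf
descendants, components correspond to the maximal clusters, leaves to the
singleton clusters, and the edge between a non-root vertex `v` and its parent
is identified with the cluster `L(v)`.
-/

open Finset

noncomputable section
open scoped Classical

/-- A rooted multifurcating phylogenetic `X`-forest, described by the laminar
family of the label sets of its vertices. -/
structure XForest (X : Type*) where
  clusters : Finset (Finset X)
  nonempty_of_mem : ∀ s ∈ clusters, s.Nonempty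
  laminar : ∀ s ∈ clusters, ∀ t ∈ clusters, ¬Disjoint s t → s ⊆ t ∨ t ⊆ s
  singleton_mem : ∀ x : X, {x} ∈ clusters

namespace XForest

variable {X : Type*} [DecidableEq X] [Fintype X]

/-- The connected components of an `X`-forest: the maximal clusters.  The
component `C` is identified with its label set `L(C)`. -/
def components (F : XForest X) : Finset (Finset X) :=
  F.clusters.filter fun s => ∀ t ∈ F.clusters, ¬s ⊂ t

/-- The order of an `X`-forest: its number of connected components. -/
def ord (F : XForest X) : ℕ := F.components.card

/-- `c` is (the cluster of) a child of (the vertex with cluster) `p`. -/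
def IsChild (F : XForest X) (c p : Finset X) : Prop :=
  c ∈ F.clusters ∧ p ∈ F.clusters ∧ c ⊂ p ∧ ∀ t ∈ F.clusters, c ⊂ t → ¬t ⊂ p

/-- The family obtained from the laminar family `A` by removing, for every
`d ∈ D`, the edge between the vertex with cluster `d` and its parent. -/
def cutFam (A D : Finset (Finset X)) : Finset (Finset X) :=
  (A.image fun s => s \ (D.filter fun d => d ⊂ s).biUnion id).filter fun s => s.Nonempty

/-- The `X`-forest obtained from `F` by removing the edges above the clusters
in `D` (followed by forced contraction). -/
def cut (F : XForest X) (D : Finset (Finset X)) : XForest X where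
  clusters := cutFam F.clusters (D.filter fun d => d ∈ F.clusters)
  nonempty_of_mem := fun s hs => (Finset.mem_filter.mp hs).2
  laminar := by
    intro s' hs' t' ht' hnd
    set D' : Finset (Finset X) := D.filter fun d => d ∈ F.clusters with hD'def
    have hD'sub : ∀ d ∈ D', d ∈ F.clusters := fun d hd => (Finset.mem_filter.mp hd).2
    obtain ⟨hs'm, -⟩ := Finset.mem_filter.mp hs'
    obtain ⟨s, hs, rfl⟩ := Finset.mem_image.mp hs'm
    obtain ⟨ht'm, -⟩ := Finset.mem_filter.mp ht'
    obtain ⟨t, ht, rfl⟩ := Finset.mem_image.mp ht'm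
    obtain ⟨x, hxs, hxt⟩ := Finset.not_disjoint_iff.mp hnd
    have key : ∀ u ∈ F.clusters, ∀ w ∈ F.clusters, u ⊆ w →
        ∀ z, z ∈ u \ (D'.filter fun d => d ⊂ u).biUnion id →
          z ∈ w \ (D'.filter fun d => d ⊂ w).biUnion id →
          u \ (D'.filter fun d => d ⊂ u).biUnion id ⊆
            w \ (D'.filter fun d => d ⊂ w).biUnion id := by
      intro u hu w hw huw z hzu hzw y hy
      rw [Finset.mem_sdiff] at hy hzu hzw ⊢
      refine ⟨huw hy.1, ?_⟩
      intro hyU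
      rw [Finset.mem_biUnion] at hyU
      obtain ⟨d, hd, hyd⟩ := hyU
      rw [Finset.mem_filter] at hd
      have hdF : d ∈ F.clusters := hD'sub d hd.1
      have hdw : d ⊂ w := hd.2
      have hlam := F.laminar d hdF u hu (Finset.not_disjoint_iff.mpr ⟨y, hyd, hy.1⟩)
      rcases hlam with hdu | hud
      · by_cases hde : d = u
        · exact hzw.2 (Finset.mem_biUnion.mpr
            ⟨d, Finset.mem_filter.mpr ⟨hd.1, hdw⟩, hde ▸ hzu.1⟩)
        · have hss : d ⊂ u := Finset.ssubset_iff_subset_ne.mpr ⟨hdu, hde⟩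
          exact hy.2 (Finset.mem_biUnion.mpr
            ⟨d, Finset.mem_filter.mpr ⟨hd.1, hss⟩, hyd⟩)
      · exact hzw.2 (Finset.mem_biUnion.mpr
          ⟨d, Finset.mem_filter.mpr ⟨hd.1, hdw⟩, hud hzu.1⟩)
    have hxs' : x ∈ s ∧ x ∈ t := by
      constructor
      · exact (Finset.mem_sdiff.mp hxs).1
      · exact (Finset.mem_sdiff.mp hxt).1
    rcases F.laminar s hs t ht (Finset.not_disjoint_iff.mpr ⟨x, hxs'.1, hxs'.2⟩) with hst | hts
    · exact Or.inl (key s hs t ht hst x hxs hxt)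
    · exact Or.inr (key t ht s hs hts x hxt hxs)
  singleton_mem := by
    intro x
    have hU : ((D.filter fun d => d ∈ F.clusters).filter fun d => d ⊂ ({x} : Finset X)) = ∅ := by
      rw [Finset.filter_eq_empty_iff]
      intro d hd hss
      have hne := F.nonempty_of_mem d (Finset.mem_filter.mp hd).2
      rw [Finset.ssubset_singleton_iff.mp hss] at hne
      exact Finset.not_nonempty_empty hne
    refine Finset.mem_filter.mpr ⟨?_, Finset.singleton_nonempty x⟩
    refine Finset.mem_image.mpr ⟨{x}, F.singleton_mem x, ?_⟩
    rw [hU]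
    simp

/-- `G` is a subforest of `F` (up to forced contraction and label-preserving
isomorphism): `G` is obtained from `F` by removing a set of edges. -/
def IsSubforest (G F : XForest X) : Prop :=
  ∃ D ⊆ F.clusters, G.clusters = (F.cut D).clusters

/-- The edge of `F` between the vertex with cluster `c` and its parent is *in*
the forest `G` (i.e. it lies on a path of `F` connecting two labels that belong
to a common connected component of `G`). -/
def EdgeUsed (F : XForest X) (c : Finset X) (G : XForest X) : Prop :=
  ∃ x ∈ c, ∃ y, y ∉ c ∧ (∃ C ∈ F.components, x ∈ C ∧ y ∈ C) ∧
    ∃ D ∈ G.components, x ∈ D ∧ y ∈ D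

/-- The least common ancestor of the two labels `a` and `b` in `F` (given as
its cluster, i.e. as the label set `L(lca_F(a,b))`). -/
def lca2 (F : XForest X) (a b : X) : Finset X :=
  (F.clusters.filter fun s => a ∈ s ∧ b ∈ s).inf id

/-- The least common ancestor of the labels of `S` in `F` (given as its
cluster). -/
def lcaS (F : XForest X) (S : Finset X) : Finset X :=
  (F.clusters.filter fun s => S ⊆ s).inf id

/-- `E^1_F(a,b)`: the edges of `F` that are not on the path `P` connecting the
labels `a` and `b` but are incident to internal vertices of this path other
than `lca_F(a,b)` (each edge is identified with the cluster of its lower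
endpoint). -/
def E1 (F : XForest X) (a b : X) : Finset (Finset X) :=
  F.clusters.filter fun d => ∃ c ∈ F.clusters, F.IsChild d c ∧ c ⊂ F.lca2 a b ∧
    ((a ∈ c ∧ c ≠ {a} ∧ a ∉ d) ∨ (b ∈ c ∧ c ≠ {b} ∧ b ∉ d))

/-- `E^2_F(a,b)`: the edges incident to `lca_F(a,b)` other than the two edges
on the path connecting `a` and `b` and the edge to the parent of the lca. -/
def E2 (F : XForest X) (a b : X) : Finset (Finset X) :=
  F.clusters.filter fun d => F.IsChild d (F.lca2 a b) ∧ a ∉ d ∧ b ∉ d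

/-- `E_F(a,b) = E^1_F(a,b) ∪ E^2_F(a,b)`. -/
def Eset (F : XForest X) (a b : X) : Finset (Finset X) := F.E1 a b ∪ F.E2 a b

/-- `E^O_F(S)`: the edges between `lca_F(S)` and its children that are not
labels in `S`. -/
def EO (F : XForest X) (S : Finset X) : Finset (Finset X) :=
  F.clusters.filter fun d => F.IsChild d (F.lcaS S) ∧ ∀ x ∈ S, d ≠ {x}

/-- `S` is a maximal sibling set (MSS) of `F`: the leaves with labels in `S`
have a common parent `p` whose children are exactly the labels in `S`
(equivalently, `S` itself is a cluster all of whose proper subclusters are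
singletons). -/
def IsMSS (F : XForest X) (S : Finset X) : Prop :=
  S ∈ F.clusters ∧ 2 ≤ S.card ∧ ∀ c ∈ F.clusters, c ⊂ S → c.card = 1

/-- the labels in `S` are (pairwise) siblings in `F`, i.e., they have a common
parent. -/
def Siblings (F : XForest X) (S : Finset X) : Prop :=
  ∃ p ∈ F.clusters, ∀ x ∈ S, F.IsChild {x} p

/-- An `X`-forest is binary if each of its non-leaf vertices has exactly two
children. -/
def IsBinary (F : XForest X) : Prop :=
  ∀ s ∈ F.clusters, 2 ≤ s.card → ∃ c₁ c₂ : Finset X, c₁ ≠ c₂ ∧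
    F.IsChild c₁ s ∧ F.IsChild c₂ s ∧ ∀ c, F.IsChild c s → c = c₁ ∨ c = c₂

/-- `B` is a resolution of `F`: `F` can be obtained from `B` by contracting
internal edges. -/
def IsResolution (B F : XForest X) : Prop :=
  F.clusters ⊆ B.clusters ∧ B.components = F.components

/-- `G` is a binary subforest of `F`: `G` is binary and is a subforest of some
binary resolution of `F`. -/
def IsBinarySubforest (G F : XForest X) : Prop :=
  G.IsBinary ∧ ∃ B : XForest X, B.IsBinary ∧ IsResolution B F ∧ IsSubforest G B

end XForest

variable {X : Type*} [DecidableEq X] [Fintype X] {m : ℕ}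

/-- A hard agreement forest for the `X`-forests `Fs`. -/
def IsHAF (Fs : Fin m → XForest X) (G : XForest X) : Prop :=
  ∀ i, XForest.IsSubforest G (Fs i)

/-- A hard maximum agreement forest (hMAF) for the `X`-forests `Fs`. -/
def IsHMAF (Fs : Fin m → XForest X) (G : XForest X) : Prop :=
  IsHAF Fs G ∧ ∀ G', IsHAF Fs G' → G.ord ≤ G'.ord

/-- A soft agreement forest for the `X`-forests `Fs`. -/
def IsSAF (Fs : Fin m → XForest X) (G : XForest X) : Prop :=
  ∀ i, XForest.IsBinarySubforest G (Fs i)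

/-- A soft maximum agreement forest (sMAF) for the `X`-forests `Fs`. -/
def IsSMAF (Fs : Fin m → XForest X) (G : XForest X) : Prop :=
  IsSAF Fs G ∧ ∀ G', IsSAF Fs G' → G.ord ≤ G'.ord

/-- An instance `(F_1, …, F_m; k)` of the (hard or soft) Maf problem. -/
structure Inst (X : Type*) (m : ℕ) where
  F : Fin m → XForest X
  k : ℤ

namespace Inst

/-- the largest order of an `X`-forest in the instance. -/
def ordMax (I : Inst X m) : ℕ := Finset.univ.sup fun i => (I.F i).ord

/-- a solution of an instance of the hMaf problem: a hard agreement forest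
whose order is at most `ordMax + k`. -/
def IsSolution (I : Inst X m) (G : XForest X) : Prop :=
  IsHAF I.F G ∧ (G.ord : ℤ) ≤ (I.ordMax : ℤ) + I.k

/-- a yes-instance of the hMaf problem. -/
def IsYes (I : Inst X m) : Prop := ∃ G, I.IsSolution G

/-- a solution of an instance of the sMaf problem. -/
def IsSSolution (I : Inst X m) (G : XForest X) : Prop :=
  IsSAF I.F G ∧ (G.ord : ℤ) ≤ (I.ordMax : ℤ) + I.k

/-- a yes-instance of the sMaf problem. -/
def IsSYes (I : Inst X m) : Prop := ∃ G, I.IsSSolution G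

/-- `S` is a minimum maximal sibling set of the instance `I`, lying in the
`i`-th forest. -/
def MinMSS (I : Inst X m) (i : Fin m) (S : Finset X) : Prop :=
  (I.F i).IsMSS S ∧ ∀ j : Fin m, ∀ S' : Finset X, (I.F j).IsMSS S' → S.card ≤ S'.card

end Inst

/-- the new value of the parameter after removing one edge from the `j`-th
forest (the maximum order `ordMax + k` stays invariant). -/
def cutk (I : Inst X m) (j : Fin m) : ℤ :=
  if (I.F j).ord = I.ordMax then I.k - 1 else I.k

/-- Reduction Rule 1 is applicable on `Fj` relative to `Fi`, at the vertex `v`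
of `Fj` (whose parent edge is to be removed): there is a subset
`{C_1, …, C_t}` (`t ≥ 1`) of the components of `Fi` and a component `C` of
`Fj` containing a non-root vertex `v` with
`L(v) = L(C) ∩ (L(C_1) ∪ … ∪ L(C_t))`. -/
def RR1App (Fi Fj : XForest X) (v : Finset X) : Prop :=
  ∃ 𝒞 ⊆ Fi.components, 𝒞.Nonempty ∧
    ∃ C ∈ Fj.components, v ∈ Fj.clusters ∧ v ⊆ C ∧ (∃ t ∈ Fj.clusters, v ⊂ t) ∧
      v = C ∩ 𝒞.biUnion id

/-- One application of Reduction Rule 1 to the instance `I`, producing `I'`. -/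
def RR1Step (I I' : Inst X m) : Prop :=
  ∃ i j, i ≠ j ∧ ∃ v, RR1App (I.F i) (I.F j) v ∧
    I' = ⟨Function.update I.F j ((I.F j).cut {v}), cutk I j⟩

/-- Reduction Rule 1 is applicable somewhere on the instance `I`. -/
def RR1Applicable (I : Inst X m) : Prop :=
  ∃ i j, i ≠ j ∧ ∃ v, RR1App (I.F i) (I.F j) v

/-- `I'` is obtained from `I` by applying Reduction Rule 1 repeatedly until it
is no longer applicable. -/
def RR1Exhaust (I I' : Inst X m) : Prop :=
  Relation.ReflTransGen RR1Step I I' ∧ ¬RR1Applicable I'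

/-- The situation of Case 1 (Branching Rule 1) for `Fj` relative to `Fi`:
there is a component `C` of `Fi` and a vertex `v` of `Fj` with two children
`c₁, c₂` such that `L(c₁) ⊆ L(C)` and `L(c₂) ∩ L(C) = ∅`. -/
def BR1AppCore (Fi Fj : XForest X) (v c₁ c₂ : Finset X) : Prop :=
  ∃ C ∈ Fi.components, Fj.IsChild c₁ v ∧ Fj.IsChild c₂ v ∧ c₁ ≠ c₂ ∧
    c₁ ⊆ C ∧ c₂ ∩ C = ∅

/-- An application of Branching Rule 1 to the instance `I` (on the forest with
index `j`, relative to the forest with index `i`), branching into the two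
instances `I₁` (removing `[v,c₁]`) and `I₂` (removing `[v,c₂]`). -/
def BR1Branch (I : Inst X m) (i j : Fin m) (v c₁ c₂ : Finset X)
    (I₁ I₂ : Inst X m) : Prop :=
  i ≠ j ∧ BR1AppCore (I.F i) (I.F j) v c₁ c₂ ∧
    I₁ = ⟨Function.update I.F j ((I.F j).cut {c₁}), cutk I j⟩ ∧
    I₂ = ⟨Function.update I.F j ((I.F j).cut {c₂}), cutk I j⟩

/-- two `X`-forests satisfy the label-set isomorphism property. -/
def LabelIso (F F' : XForest X) : Prop := F.components = F'.components

/-- an instance satisfies the label-set isomorphism property. -/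
def InstLabelIso (I : Inst X m) : Prop := ∀ i j, LabelIso (I.F i) (I.F j)

/-- One computation path of the 2-BR-process on the forests with indices `p`
and `q`: repeatedly apply Branching Rule 1 between these two forests (choosing
one of the two branches) followed by an exhaustive application of Reduction
Rule 1, until the two forests satisfy the label-set isomorphism property.  The
natural number records the number of edges removed by Branching Rule 1 along
the path. -/
inductive TwoBRPath {X : Type*} [DecidableEq X] [Fintype X] {m : ℕ} (p q : Fin m) :
    Inst X m → Inst X m → ℕ → Prop
  | done (I : Inst X m) (h : LabelIso (I.F p) (I.F q)) : TwoBRPath p q I I 0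
  | step {I I₁ I₂ J K I' : Inst X m} {n : ℕ} {i j : Fin m} {v c₁ c₂ : Finset X}
      (hij : (i = p ∧ j = q) ∨ (i = q ∧ j = p))
      (hbr : BR1Branch I i j v c₁ c₂ I₁ I₂)
      (hpick : J = I₁ ∨ J = I₂)
      (hex : RR1Exhaust J K)
      (hrest : TwoBRPath p q K I' n) : TwoBRPath p q I I' (n + 1)

/-- `s` and `t` are the indices of two forests with the first and the second
largest orders in `I`. -/
def FirstSecond (I : Inst X m) (s t : Fin m) : Prop :=
  s ≠ t ∧ (∀ i, (I.F i).ord ≤ (I.F s).ord) ∧ ∀ i, i ≠ s → (I.F i).ord ≤ (I.F t).ord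

/-- One computation path of Stage 2 of the m-BR-process: repeatedly apply the
2-BR-process to two forests with first and second largest orders not
satisfying the label-set isomorphism property, until the whole instance
satisfies the label-set isomorphism property. -/
inductive MBRAux {X : Type*} [DecidableEq X] [Fintype X] {m : ℕ} :
    Inst X m → Inst X m → ℕ → Prop
  | done (I : Inst X m) (h : InstLabelIso I) : MBRAux I I 0
  | step {I J I' : Inst X m} {a b : ℕ} {s t : Fin m}
      (hst : FirstSecond I s t) (hni : ¬LabelIso (I.F s) (I.F t))
      (h2 : TwoBRPath s t I J a) (hrest : MBRAux J I' b) : MBRAux I I' (a + b)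

/-- One computation path of the m-BR-process on the instance `I`, ending at
the instance `I'`, along which `n` edges are removed by Branching Rule 1. -/
def MBRPath (I I' : Inst X m) (n : ℕ) : Prop :=
  ∃ J, RR1Exhaust I J ∧ MBRAux J I' n

/-- The full branching tree of the 2-BR-process on the forests with indices
`p` and `q`, producing the collection (list) of resulting instances, each
together with the number of edges removed by Branching Rule 1 on its
computation path. -/
inductive TwoBRTree {X : Type*} [DecidableEq X] [Fintype X] {m : ℕ} (p q : Fin m) :
    Inst X m → List (Inst X m × ℕ) → Prop
  | done (I : Inst X m) (h : LabelIso (I.F p) (I.F q)) : TwoBRTree p q I [(I, 0)]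
  | step {I I₁ I₂ K₁ K₂ : Inst X m} {L₁ L₂ : List (Inst X m × ℕ)}
      {i j : Fin m} {v c₁ c₂ : Finset X}
      (hij : (i = p ∧ j = q) ∨ (i = q ∧ j = p))
      (hbr : BR1Branch I i j v c₁ c₂ I₁ I₂)
      (he₁ : RR1Exhaust I₁ K₁) (he₂ : RR1Exhaust I₂ K₂)
      (h₁ : TwoBRTree p q K₁ L₁) (h₂ : TwoBRTree p q K₂ L₂) :
      TwoBRTree p q I ((L₁ ++ L₂).map fun x => (x.1, x.2 + 1))

/-- One step of Stage 2 of the m-BR-process on a collection of instances: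
replace an instance, in which two forests of first and second largest orders
do not satisfy the label-set isomorphism property, by the collection produced
by the 2-BR-process on those two forests. -/
inductive CollStep {X : Type*} [DecidableEq X] [Fintype X] {m : ℕ} :
    List (Inst X m × ℕ) → List (Inst X m × ℕ) → Prop
  | step {I : Inst X m} {n : ℕ} {A B L : List (Inst X m × ℕ)} {s t : Fin m}
      (hst : FirstSecond I s t) (hni : ¬LabelIso (I.F s) (I.F t))
      (h : TwoBRTree s t I L) :
      CollStep (A ++ (I, n) :: B) (A ++ L.map (fun y => (y.1, y.2 + n)) ++ B)

/-- The m-BR-process on the instance `I` produces the collection `L` of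
instances (each recorded with the number of edges removed by Branching Rule 1
on the path leading to it): Stage 1 applies Reduction Rule 1 exhaustively, and
Stage 2 repeatedly applies the 2-BR-process until every instance of the
collection satisfies the label-set isomorphism property. -/
def MBRTree (I : Inst X m) (L : List (Inst X m × ℕ)) : Prop :=
  ∃ J, RR1Exhaust I J ∧ Relation.ReflTransGen CollStep [(J, 0)] L ∧
    ∀ x ∈ L, InstLabelIso x.1

/-- The 2-edge distance property of an instance. -/
def TwoEdgeDist (I : Inst X m) : Prop :=
  ∃ (G : Inst X m) (E : Fin m → Finset (Finset X)),
    InstLabelIso G ∧ G.k = I.k + 1 ∧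
    (∀ i, E i ⊆ (G.F i).clusters) ∧ (∀ i, (E i).card ≤ 1) ∧
    (∀ i, ∀ v ∈ E i, ∃ t ∈ (G.F i).clusters, v ⊂ t) ∧
    (∀ i, (I.F i).clusters = ((G.F i).cut (E i)).clusters) ∧
    ∃ i j : Fin m, i < j ∧ ∃ vi ∈ E i, ∃ vj ∈ E j, vi ≠ vj

/-- A branching step producing instances with parameters `ks` from an instance
with parameter `k` satisfies the recurrence relation
`T(k) ≤ c₁·T(k-1) + c₂·T(k-2)`:  for every nonnegative monotone `T` satisfying
the recurrence, the sum of the `T`-values of the produced parameters is at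
most `T k`. -/
def RecBound (k : ℤ) (ks : List ℤ) (c₁ c₂ : ℕ) : Prop :=
  ∀ T : ℤ → ℝ, (∀ x, 0 ≤ T x) → Monotone T →
    (∀ x : ℤ, (c₁ : ℝ) * T (x - 1) + (c₂ : ℝ) * T (x - 2) ≤ T x) →
    (ks.map T).sum ≤ T k

end

namespace XForest

section aux
variable {X : Type*} [DecidableEq X] [Fintype X]

theorem child_disj {F : XForest X} {a b v : Finset X} (ha : F.IsChild a v) (hb : F.IsChild b v)
    (hne : a ≠ b) : Disjoint a b := by
  by_contra h
  rcases F.laminar a ha.1 b hb.1 h with h | h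
  · exact ha.2.2.2 b hb.1 (Finset.ssubset_iff_subset_ne.mpr ⟨h, hne⟩) hb.2.2.1
  · exact hb.2.2.2 a ha.1 (Finset.ssubset_iff_subset_ne.mpr ⟨h, hne.symm⟩) ha.2.2.1

theorem exists_child {F : XForest X} {f v : Finset X} (hf : f ∈ F.clusters) (hv : v ∈ F.clusters)
    (hfv : f ⊂ v) : ∃ c, F.IsChild c v ∧ f ⊆ c := by
  classical
  have hne : (F.clusters.filter fun t => f ⊆ t ∧ t ⊂ v).Nonempty :=
    ⟨f, by simp [hf, hfv]⟩
  obtain ⟨c, hc, hmax⟩ := Finset.exists_max_image _ (fun t => t.card) hne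
  simp only [Finset.mem_filter] at hc hmax
  refine ⟨c, ⟨hc.1, hv, hc.2.2, fun t ht hct htv => ?_⟩, hc.2.1⟩
  have := hmax t ⟨ht, hc.2.1.trans hct.1, htv⟩
  have := Finset.card_lt_card hct
  omega

/-- every non-leaf cluster splits into two clusters -/
def Split (F : XForest X) : Prop :=
  ∀ s ∈ F.clusters, 2 ≤ s.card → ∃ a ∈ F.clusters, ∃ b ∈ F.clusters, Disjoint a b ∧ s = a ∪ b

theorem IsBinary.split {F : XForest X} (h : F.IsBinary) : F.Split := by
  intro s hs h2
  obtain ⟨a, b, hne, ha, hb, hall⟩ := h s hs h2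
  refine ⟨a, ha.1, b, hb.1, child_disj ha hb hne, ?_⟩
  apply Finset.Subset.antisymm
  · intro x hx
    have hxs : ({x} : Finset X) ⊂ s := by
      rw [Finset.ssubset_iff_subset_ne]
      refine ⟨by simpa using hx, ?_⟩
      rintro rfl
      simp at h2
    obtain ⟨c, hc, hxc⟩ := exists_child (F.singleton_mem x) hs hxs
    have hxc : x ∈ c := by simpa using hxc
    rcases hall c hc with rfl | rfl <;> simp [hxc]
  · exact Finset.union_subset ha.2.2.1.1 hb.2.2.1.1

theorem Split.child_left {F : XForest X} {s a b : Finset X} (hs : s ∈ F.clusters)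
    (ha : a ∈ F.clusters) (hb : b ∈ F.clusters) (hd : Disjoint a b) (he : s = a ∪ b) :
    F.IsChild a s := by
  obtain ⟨x, hx⟩ := F.nonempty_of_mem a ha
  obtain ⟨y, hy⟩ := F.nonempty_of_mem b hb
  rw [Finset.disjoint_left] at hd
  subst he
  refine ⟨ha, hs, ?_, ?_⟩
  · refine ⟨Finset.subset_union_left, fun h => ?_⟩
    exact hd (h (Finset.mem_union_right _ hy)) hy
  · intro t ht hat hts
    obtain ⟨z, hzt, hza⟩ := Finset.exists_of_ssubset hat
    have hzb : z ∈ b := by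
      have := hts.1 hzt
      simpa [hza] using this
    rcases F.laminar t ht b hb (Finset.not_disjoint_iff.mpr ⟨z, hzt, hzb⟩) with h | h
    · exact hd hx (h (hat.1 hx))
    · exact hts.2 (Finset.union_subset hat.1 h)

theorem Split.binary {F : XForest X} (h : F.Split) : F.IsBinary := by
  intro s hs h2
  obtain ⟨a, ha, b, hb, hd, he⟩ := h s hs h2
  have ca := Split.child_left hs ha hb hd he
  have cb := Split.child_left hs hb ha hd.symm (by rw [he, Finset.union_comm])
  have hne : a ≠ b := by
    rintro rfl
    obtain ⟨x, hx⟩ := F.nonempty_of_mem a ha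
    exact Finset.disjoint_left.mp hd hx hx
  refine ⟨a, b, hne, ca, cb, fun c hc => ?_⟩
  by_contra! hcon
  have h1 := child_disj hc ca hcon.1
  have h2 := child_disj hc cb hcon.2
  obtain ⟨x, hx⟩ := F.nonempty_of_mem c hc.1
  have := hc.2.2.1.1 hx
  rw [he, Finset.mem_union] at this
  rcases this with h | h
  · exact Finset.disjoint_left.mp h1 hx h
  · exact Finset.disjoint_left.mp h2 hx h

theorem comp_of_cluster (G : XForest X) {g : Finset X} (hg : g ∈ G.clusters) :
    ∃ C ∈ G.components, g ⊆ C := by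
  classical
  have hne : (G.clusters.filter fun t => g ⊆ t).Nonempty := ⟨g, by simp [hg]⟩
  obtain ⟨c, hc, hmax⟩ := Finset.exists_max_image _ (fun t => t.card) hne
  simp only [Finset.mem_filter] at hc hmax
  refine ⟨c, ?_, hc.2⟩
  simp only [components, Finset.mem_filter]
  refine ⟨hc.1, fun t ht hct => ?_⟩
  have := hmax t ⟨ht, hc.2.trans hct.1⟩
  have := Finset.card_lt_card hct
  omega

theorem comp_mem {G : XForest X} {C : Finset X} (hC : C ∈ G.components) : C ∈ G.clusters := by
  simp only [components, Finset.mem_filter] at hC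
  exact hC.1

theorem comp_max {G : XForest X} {C t : Finset X} (hC : C ∈ G.components) (ht : t ∈ G.clusters)
    {x : X} (hx : x ∈ C) (hxt : x ∈ t) : t ⊆ C := by
  simp only [components, Finset.mem_filter] at hC
  rcases G.laminar C hC.1 t ht (Finset.not_disjoint_iff.mpr ⟨x, hx, hxt⟩) with h | h
  · by_contra hn
    exact hC.2 t ht ⟨h, hn⟩
  · exact h

theorem comp_eq {G : XForest X} {C C' : Finset X} (hC : C ∈ G.components) (hC' : C' ∈ G.components)
    {x : X} (hx : x ∈ C) (hx' : x ∈ C') : C = C' :=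
  Finset.Subset.antisymm (comp_max hC' (comp_mem hC) hx' hx) (comp_max hC (comp_mem hC') hx hx')

/-- the component `C` uses the edge above `s` -/
def Cross (C s : Finset X) : Prop := (∃ x ∈ C, x ∈ s) ∧ ¬ C ⊆ s

/-- edge-disjointness and compatibility of clusters -/
def Good (G B : XForest X) : Prop :=
  (∀ s ∈ B.clusters, ∀ C ∈ G.components, ∀ C' ∈ G.components, Cross C s → Cross C' s → C = C') ∧
  (∀ s ∈ B.clusters, ∀ C ∈ G.components, (s ∩ C).Nonempty → s ∩ C ∈ G.clusters) ∧
  (∀ g ∈ G.clusters, ∃ s ∈ B.clusters, ∃ C ∈ G.components, g = s ∩ C)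

/-- what remains of `s` after cutting `D` -/
def Rem (D : Finset (Finset X)) (s : Finset X) (x : X) : Prop :=
  x ∈ s ∧ ∀ d ∈ D, d ⊂ s → x ∉ d

theorem mem_cut {B : XForest X} {D : Finset (Finset X)} (hD : D ⊆ B.clusters) (g : Finset X) :
    g ∈ (B.cut D).clusters ↔ g.Nonempty ∧ ∃ s ∈ B.clusters, ∀ x, x ∈ g ↔ Rem D s x := by
  have hDD : (D.filter fun d => d ∈ B.clusters) = D :=
    Finset.filter_true_of_mem fun d hd => hD hd
  have key : ∀ s : Finset X, (s \ (D.filter fun d => d ⊂ s).biUnion id = g) ↔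
      ∀ x, x ∈ g ↔ Rem D s x := by
    intro s
    rw [eq_comm, Finset.ext_iff]
    apply forall_congr'
    intro x
    simp [Rem]
  simp only [cut, cutFam, Finset.mem_filter, Finset.mem_image]
  rw [and_comm]
  apply and_congr_right
  intro _
  apply exists_congr
  intro s
  apply and_congr_right
  intro _
  rw [← key]
  constructor
  · intro h
    rw [← h]
    ext x
    simp only [Finset.mem_sdiff, Finset.mem_biUnion, Finset.mem_filter, id]
    constructor
    · rintro ⟨h1, h2⟩
      exact ⟨h1, fun ⟨d, hd, hx⟩ => h2 ⟨d, ⟨⟨hd.1.1, hd.2⟩, hx⟩⟩⟩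
    · rintro ⟨h1, h2⟩
      exact ⟨h1, fun ⟨d, hd, hx⟩ => h2 ⟨d, ⟨⟨hd.1, hD hd.1⟩, hd.2⟩, hx⟩⟩
  · intro h
    rw [← h]
    ext x
    simp only [Finset.mem_sdiff, Finset.mem_biUnion, Finset.mem_filter, id]
    constructor
    · rintro ⟨h1, h2⟩
      exact ⟨h1, fun ⟨d, hd, hx⟩ => h2 ⟨d, ⟨⟨hd.1, hD hd.1⟩, hd.2⟩, hx⟩⟩
    · rintro ⟨h1, h2⟩
      exact ⟨h1, fun ⟨d, hd, hx⟩ => h2 ⟨d, ⟨⟨hd.1.1, hd.2⟩, hx⟩⟩⟩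

theorem IsSubforest.good {G B : XForest X} (h : IsSubforest G B) : Good G B := by
  classical
  obtain ⟨D, hD, hG⟩ := h
  have hmem : ∀ g, g ∈ G.clusters ↔
      g.Nonempty ∧ ∃ s ∈ B.clusters, ∀ x, x ∈ g ↔ Rem D s x := by
    intro g
    rw [hG]
    exact mem_cut hD g
  -- nested remainders
  have sub : ∀ s ∈ B.clusters, ∀ p ∈ B.clusters, s ⊂ p → ∀ C ∈ G.components,
      (∀ x, x ∈ C ↔ Rem D p x) → (s ∩ C).Nonempty → ∀ x, x ∈ s ∩ C ↔ Rem D s x := by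
    intro s hs p hp hsp C hC hCp ⟨y, hy⟩
    have h1 : ∀ x, x ∈ s ∩ C → Rem D s x := by
      intro x hx
      rw [Finset.mem_inter, hCp] at hx
      exact ⟨hx.1, fun d hd hds => hx.2.2 d hd (hds.trans hsp)⟩
    intro x
    refine ⟨h1 x, fun hx => ?_⟩
    have hg : (s.filter fun x => Rem D s x) ∈ G.clusters := by
      rw [hmem]
      refine ⟨⟨x, by simp [hx, hx.1]⟩, s, hs, fun z => ?_⟩
      simp only [Finset.mem_filter, and_iff_right_iff_imp]
      exact fun h => h.1
    have hyC : y ∈ C := (Finset.mem_inter.mp hy).2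
    have := comp_max hC hg hyC (by simp [h1 y hy, (h1 y hy).1])
    exact Finset.mem_inter.mpr ⟨hx.1, this (by simp [hx, hx.1])⟩
  have comp : ∀ C ∈ G.components, ∃ p ∈ B.clusters, ∀ x, x ∈ C ↔ Rem D p x := by
    intro C hC
    exact ((hmem C).mp (comp_mem hC)).2
  refine ⟨?_, ?_, ?_⟩
  · intro s hs C hC C' hC' hc hc'
    have crs : ∀ C ∈ G.components, Cross C s → (∀ x, x ∈ s ∩ C ↔ Rem D s x) := by
      rintro C hC ⟨⟨x, hxC, hxs⟩, hn⟩
      obtain ⟨p, hp, hCp⟩ := comp C hC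
      have hxp : x ∈ p := ((hCp x).mp hxC).1
      have hps : ¬ p ⊆ s := fun h => hn fun z hz => h ((hCp z).mp hz).1
      refine sub s hs p hp ?_ C hC hCp ⟨x, by simp [hxC, hxs]⟩
      rcases B.laminar s hs p hp (Finset.not_disjoint_iff.mpr ⟨x, hxs, hxp⟩) with h | h
      · exact ⟨h, hps⟩
      · exact absurd h hps
    obtain ⟨⟨x, hxC, hxs⟩, -⟩ := id hc
    have h1 := (crs C hC hc x).mp (by simp [hxC, hxs])
    have h2 := (crs C' hC' hc' x).mpr h1
    exact comp_eq hC hC' hxC (Finset.mem_inter.mp h2).2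
  · intro s hs C hC hne
    obtain ⟨p, hp, hCp⟩ := comp C hC
    obtain ⟨x, hx⟩ := id hne
    rw [Finset.mem_inter] at hx
    by_cases hps : p ⊆ s
    · have : s ∩ C = C := Finset.inter_eq_right.mpr fun z hz => hps ((hCp z).mp hz).1
      rw [this]
      exact comp_mem hC
    · have hsp : s ⊂ p := by
        rcases B.laminar s hs p hp
          (Finset.not_disjoint_iff.mpr ⟨x, hx.1, ((hCp x).mp hx.2).1⟩) with h | h
        · exact ⟨h, hps⟩
        · exact absurd h hps
      exact (hmem _).mpr ⟨hne, s, hs, sub s hs p hp hsp C hC hCp hne⟩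
  · intro g hg
    obtain ⟨⟨y, hy⟩, s, hs, hgs⟩ := (hmem g).mp hg
    obtain ⟨C, hC, hgC⟩ := comp_of_cluster G hg
    obtain ⟨p, hp, hCp⟩ := comp C hC
    have hys := (hgs y).mp hy
    have hyp := (hCp y).mp (hgC hy)
    refine ⟨s, hs, C, hC, ?_⟩
    apply Finset.Subset.antisymm
    · intro x hx
      exact Finset.mem_inter.mpr ⟨((hgs x).mp hx).1, hgC hx⟩
    · intro x hx
      by_cases hps : p ⊆ s
      · rw [hgs]
        rw [Finset.mem_inter] at hx
        refine ⟨hx.1, fun d hd hds hxd => ?_⟩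
        have hxp := (hCp x).mp hx.2
        rcases B.laminar d (hD hd) p hp (Finset.not_disjoint_iff.mpr ⟨x, hxd, hxp.1⟩) with h | h
        · by_cases hpd : p ⊆ d
          · exact hys.2 d hd hds (hpd hyp.1)
          · exact hxp.2 d hd ⟨h, hpd⟩ hxd
        · exact hys.2 d hd hds (h hyp.1)
      · have hsp : s ⊂ p := by
          rcases B.laminar s hs p hp
            (Finset.not_disjoint_iff.mpr ⟨y, hys.1, hyp.1⟩) with h | h
          · exact ⟨h, hps⟩
          · exact absurd h hps
        rw [hgs]
        exact (sub s hs p hp hsp C hC hCp ⟨x, hx⟩ x).mp hx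

theorem Good.subforest {G B : XForest X} (hB : B.Split) (h : Good G B) : IsSubforest G B := by
  classical
  obtain ⟨huniq, hin, hex⟩ := h
  set D : Finset (Finset X) := B.clusters.filter fun s => ∀ C ∈ G.components, ¬ Cross C s with hDdef
  have hD : D ⊆ B.clusters := Finset.filter_subset _ _
  have hDm : ∀ d, d ∈ D ↔ d ∈ B.clusters ∧ ∀ C ∈ G.components, ¬ Cross C d := by
    intro d
    simp [hDdef]
  have hDC : ∀ d ∈ D, ∀ C ∈ G.components, ∀ x ∈ C, x ∈ d → C ⊆ d := by
    intro d hd C hC x hx hxd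
    by_contra hn
    exact ((hDm d).mp hd).2 C hC ⟨⟨x, hx, hxd⟩, hn⟩
  have hsplit : ∀ s ∈ B.clusters, ∀ x ∈ s, s = {x} ∨ ∃ a ∈ B.clusters, ∃ b ∈ B.clusters,
      Disjoint a b ∧ s = a ∪ b ∧ x ∈ a := by
    intro s hs x hx
    by_cases h2 : 2 ≤ s.card
    · right
      obtain ⟨a, ha, b, hb, hd, he⟩ := hB s hs h2
      have hx' := hx
      rw [he, Finset.mem_union] at hx'
      rcases hx' with h | h
      · exact ⟨a, ha, b, hb, hd, he, h⟩
      · exact ⟨b, hb, a, ha, hd.symm, by rw [he, Finset.union_comm], h⟩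
    · left
      have h1 : s.card = 1 := by
        have := Finset.card_pos.mpr ⟨x, hx⟩
        omega
      obtain ⟨y, rfl⟩ := Finset.card_eq_one.mp h1
      simp at hx
      rw [hx]
  have other : ∀ a b C : Finset X, Disjoint a b → C ⊆ a ∪ b → Cross C a → Cross C b := by
    rintro a b C hd hC ⟨⟨x, hxC, hxa⟩, hn⟩
    obtain ⟨y, hyC, hya⟩ := Finset.not_subset.mp hn
    have hyb : y ∈ b := by simpa [hya] using hC hyC
    exact ⟨⟨y, hyC, hyb⟩, fun h => Finset.disjoint_left.mp hd hxa (h hxC)⟩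
  have up : ∀ n : ℕ, ∀ s ∈ B.clusters, s.card ≤ n → ∀ x ∈ s, (∀ d ∈ D, d ⊆ s → x ∉ d) →
      ∃ C ∈ G.components, Cross C s ∧ x ∈ C := by
    intro n
    induction n with
    | zero =>
      intro s hs hc x hx
      have := Finset.card_pos.mpr ⟨x, hx⟩
      omega
    | succ n ih =>
      intro s hs hc x hx hno
      have hsD : s ∉ D := fun h => hno s h (Finset.Subset.refl _) hx
      rw [hDm] at hsD
      push Not at hsD
      obtain ⟨C', hC', hcr'⟩ := hsD hs
      rcases hsplit s hs x hx with he | ⟨a, ha, b, hb, hd, he, hxa⟩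
      · refine ⟨C', hC', hcr', ?_⟩
        obtain ⟨⟨y, hy, hys⟩, -⟩ := hcr'
        rw [he, Finset.mem_singleton] at hys
        exact hys ▸ hy
      · have hlt : a.card < s.card :=
          Finset.card_lt_card (Split.child_left hs ha hb hd he).2.2.1
        have has : a ⊆ s := he ▸ Finset.subset_union_left
        obtain ⟨C, hC, hcr, hxC⟩ := ih a ha (by omega) x hxa
          fun d hd hda => hno d hd (hda.trans has)
        refine ⟨C, hC, ⟨⟨x, hxC, hx⟩, fun hCs => ?_⟩, hxC⟩
        have hcb : Cross C b := other a b C hd (he ▸ hCs) hcr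
        obtain ⟨⟨y, hy, hys⟩, hn'⟩ := hcr'
        have hbs : b ⊆ s := he ▸ Finset.subset_union_right
        have : C = C' := by
          rw [he, Finset.mem_union] at hys
          rcases hys with h | h
          · exact huniq a ha C hC C' hC' hcr ⟨⟨y, hy, h⟩, fun h' => hn' (h'.trans has)⟩
          · exact huniq b hb C hC C' hC' hcb ⟨⟨y, hy, h⟩, fun h' => hn' (h'.trans hbs)⟩
        exact hn' (this ▸ hCs)
  have rem : ∀ s ∈ B.clusters, ∀ x, Rem D s x → ∃ C ∈ G.components, ∀ y, Rem D s y ↔ y ∈ s ∩ C := by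
    intro s hs x hx
    by_cases hsD : s ∈ D
    · rcases hsplit s hs x hx.1 with he | ⟨a, ha, b, hb, hd, he, hxa⟩
      · obtain ⟨C, hC, hxC⟩ := comp_of_cluster G (G.singleton_mem x)
        have hxC : x ∈ C := by simpa using hxC
        refine ⟨C, hC, fun y => ?_⟩
        rw [Finset.mem_inter]
        constructor
        · intro hy
          have : y = x := by simpa [he] using hy.1
          exact ⟨hy.1, this ▸ hxC⟩
        · intro hy
          have : y = x := by simpa [he] using hy.1
          exact this ▸ hx
      · have hca := Split.child_left hs ha hb hd he
        have hcb := Split.child_left hs hb ha hd.symm (by rw [he, Finset.union_comm])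
        have upa : ∀ y ∈ a, Rem D s y → ∃ C ∈ G.components, Cross C a ∧ y ∈ C := fun y hya hy =>
          up a.card a ha le_rfl y hya
            fun d hd hda => hy.2 d hd (Finset.ssubset_of_subset_of_ssubset hda hca.2.2.1)
        have upb : ∀ y ∈ b, Rem D s y → ∃ C ∈ G.components, Cross C b ∧ y ∈ C := fun y hya hy =>
          up b.card b hb le_rfl y hya
            fun d hd hda => hy.2 d hd (Finset.ssubset_of_subset_of_ssubset hda hcb.2.2.1)
        obtain ⟨C, hC, hcr, hxC⟩ := upa x hxa hx
        have hCs : C ⊆ s := hDC s hsD C hC x hxC hx.1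
        have hcrb : Cross C b := other a b C hd (he ▸ hCs) hcr
        refine ⟨C, hC, fun y => ?_⟩
        rw [Finset.mem_inter]
        constructor
        · intro hy
          refine ⟨hy.1, ?_⟩
          have hys := hy.1
          rw [he, Finset.mem_union] at hys
          rcases hys with h | h
          · obtain ⟨C', hC', hcr', hy'⟩ := upa y h hy
            rw [huniq a ha C hC C' hC' hcr hcr']
            exact hy'
          · obtain ⟨C', hC', hcr', hy'⟩ := upb y h hy
            rw [huniq b hb C hC C' hC' hcrb hcr']
            exact hy'
        · rintro ⟨hys, hyC⟩
          refine ⟨hys, fun d hdD hds hyd => ?_⟩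
          have hCd := hDC d hdD C hC y hyC hyd
          obtain ⟨⟨z, hzC, hza⟩, hna⟩ := hcr
          obtain ⟨⟨w, hwC, hwb⟩, hnb⟩ := hcrb
          have h1 : a ⊆ d := by
            rcases B.laminar a ha d (hD hdD)
              (Finset.not_disjoint_iff.mpr ⟨z, hza, hCd hzC⟩) with h | h
            · exact h
            · exact absurd (hCd.trans h) hna
          have h2 : b ⊆ d := by
            rcases B.laminar b hb d (hD hdD)
              (Finset.not_disjoint_iff.mpr ⟨w, hwb, hCd hwC⟩) with h | h
            · exact h
            · exact absurd (hCd.trans h) hnb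
          exact hds.2 (he ▸ Finset.union_subset h1 h2)
    · have star : ∀ y, Rem D s y → ∃ C ∈ G.components, Cross C s ∧ y ∈ C := by
        intro y hy
        refine up s.card s hs le_rfl y hy.1 fun d hd hds hyd => ?_
        by_cases h : s ⊆ d
        · exact hsD (Finset.Subset.antisymm h hds ▸ hd)
        · exact hy.2 d hd ⟨hds, h⟩ hyd
      obtain ⟨C, hC, hcr, hxC⟩ := star x hx
      refine ⟨C, hC, fun y => ?_⟩
      rw [Finset.mem_inter]
      constructor
      · intro hy
        obtain ⟨C', hC', hcr', hyC'⟩ := star y hy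
        rw [huniq s hs C hC C' hC' hcr hcr']
        exact ⟨hy.1, hyC'⟩
      · rintro ⟨hys, hyC⟩
        exact ⟨hys, fun d hd hds hyd => hcr.2 ((hDC d hd C hC y hyC hyd).trans hds.1)⟩
  refine ⟨D, hD, ?_⟩
  ext g
  rw [mem_cut hD]
  constructor
  · intro hg
    refine ⟨G.nonempty_of_mem g hg, ?_⟩
    obtain ⟨s, hs, C, hC, hgs⟩ := hex g hg
    have hne : (B.clusters.filter fun t => g ⊆ t).Nonempty :=
      ⟨s, by simp [hs, hgs]⟩
    obtain ⟨t, ht, hmin⟩ := Finset.exists_min_image _ (fun t => t.card) hne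
    simp only [Finset.mem_filter] at ht hmin
    obtain ⟨y, hy⟩ := G.nonempty_of_mem g hg
    have hys : y ∈ s ∩ C := hgs ▸ hy
    rw [Finset.mem_inter] at hys
    have hts : t ⊆ s := by
      rcases B.laminar t ht.1 s hs
        (Finset.not_disjoint_iff.mpr ⟨y, ht.2 hy, hys.1⟩) with h | h
      · exact h
      · rw [Finset.eq_of_subset_of_card_le h (hmin s ⟨hs, by simp [hgs]⟩)]
    have hrem : ∀ z ∈ g, Rem D t z := by
      intro z hz
      refine ⟨ht.2 hz, fun d hd hdt hzd => ?_⟩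
      have hzC : z ∈ C := by
        rw [hgs, Finset.mem_inter] at hz
        exact hz.2
      have hCd := hDC d hd C hC z hzC hzd
      have := hmin d ⟨hD hd, by rw [hgs]; exact Finset.inter_subset_right.trans hCd⟩
      have := Finset.card_lt_card hdt
      omega
    obtain ⟨C', hC', hall⟩ := rem t ht.1 y (hrem y hy)
    have hCC : C = C' :=
      comp_eq hC hC' hys.2 (Finset.mem_inter.mp ((hall y).mp (hrem y hy))).2
    subst hCC
    refine ⟨t, ht.1, fun z => ⟨hrem z, fun hz => ?_⟩⟩
    have := (hall z).mp hz
    rw [Finset.mem_inter] at this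
    rw [hgs]
    exact Finset.mem_inter.mpr ⟨hts this.1, this.2⟩
  · rintro ⟨⟨x, hx⟩, s, hs, hall⟩
    obtain ⟨C, hC, hrem⟩ := rem s hs x ((hall x).mp hx)
    have : g = s ∩ C := by
      ext z
      rw [hall, hrem]
    rw [this]
    exact hin s hs C hC ⟨x, this ▸ hx⟩

theorem comps_eq {A B : XForest X} {v : Finset X} (hvA : v ∈ A.clusters) (hvB : v ∈ B.clusters)
    (h : ∀ u, ¬ u ⊂ v → (u ∈ A.clusters ↔ u ∈ B.clusters)) : A.components = B.components := by
  have key : ∀ A B : XForest X, v ∈ A.clusters → v ∈ B.clusters →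
      (∀ u, ¬ u ⊂ v → (u ∈ A.clusters ↔ u ∈ B.clusters)) → A.components ⊆ B.components := by
    intro A B hvA hvB h u hu
    simp only [components, Finset.mem_filter] at hu ⊢
    have huv := hu.2 v hvA
    refine ⟨(h u huv).mp hu.1, fun t ht hut => ?_⟩
    exact hu.2 t ((h t fun htv => huv (hut.trans htv)).mpr ht) hut
  exact Finset.Subset.antisymm (key A B hvA hvB h)
    (key B A hvB hvA fun u hu => (h u hu).symm)

/-- membership in the modified resolution -/
def NewMem (B : XForest X) (v S u : Finset X) : Prop :=
  u.Nonempty ∧ ((u ∈ B.clusters ∧ ¬ u ⊂ v) ∨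
    ∃ t ∈ B.clusters, t ⊆ v ∧ ∃ E, (E = S ∨ E = v \ S) ∧ u = t ∩ E)

theorem exists_new (B : XForest X) {v S : Finset X} (hv : v ∈ B.clusters) :
    ∃ B' : XForest X, ∀ u, u ∈ B'.clusters ↔ NewMem B v S u := by
  classical
  have mixed : ∀ u w, u ∈ B.clusters → ¬ u ⊂ v → (∃ t ∈ B.clusters, t ⊆ v ∧
      ∃ E, (E = S ∨ E = v \ S) ∧ w = t ∩ E) → ¬ Disjoint u w → w ⊆ u := by
    rintro u w hu huv ⟨t, ht, htv, E, -, rfl⟩ hnd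
    obtain ⟨x, hxu, hxw⟩ := Finset.not_disjoint_iff.mp hnd
    have hwv : t ∩ E ⊆ v := Finset.inter_subset_left.trans htv
    rcases B.laminar u hu v hv (Finset.not_disjoint_iff.mpr ⟨x, hxu, hwv hxw⟩) with h | h
    · by_cases h' : v ⊆ u
      · exact hwv.trans h'
      · exact absurd ⟨h, h'⟩ huv
    · exact hwv.trans h
  refine ⟨⟨Finset.univ.filter fun u => NewMem B v S u, ?_, ?_, ?_⟩, ?_⟩
  · intro s hs
    exact (Finset.mem_filter.mp hs).2.1
  · intro u hu w hw hnd
    have hu' := (Finset.mem_filter.mp hu).2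
    have hw' := (Finset.mem_filter.mp hw).2
    rcases hu'.2 with hu1 | hu1 <;> rcases hw'.2 with hw1 | hw1
    · exact B.laminar u hu1.1 w hw1.1 hnd
    · exact Or.inr (mixed u w hu1.1 hu1.2 hw1 hnd)
    · exact Or.inl (mixed w u hw1.1 hw1.2 hu1 fun h => hnd h.symm)
    · obtain ⟨t, ht, htv, E, hE, rfl⟩ := hu1
      obtain ⟨t', ht', htv', E', hE', rfl⟩ := hw1
      obtain ⟨x, hx, hx'⟩ := Finset.not_disjoint_iff.mp hnd
      rw [Finset.mem_inter] at hx hx'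
      have hEE : E = E' := by
        rcases hE with rfl | rfl <;> rcases hE' with rfl | rfl
        · rfl
        · exact absurd hx.2 (Finset.mem_sdiff.mp hx'.2).2
        · exact absurd hx'.2 (Finset.mem_sdiff.mp hx.2).2
        · rfl
      subst hEE
      rcases B.laminar t ht t' ht' (Finset.not_disjoint_iff.mpr ⟨x, hx.1, hx'.1⟩) with h | h
      · exact Or.inl (Finset.inter_subset_inter_right h)
      · exact Or.inr (Finset.inter_subset_inter_right h)
  · intro x
    refine Finset.mem_filter.mpr ⟨Finset.mem_univ _, Finset.singleton_nonempty x, ?_⟩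
    by_cases hxv : x ∈ v
    · right
      refine ⟨{x}, B.singleton_mem x, by simpa using hxv, ?_⟩
      by_cases hxS : x ∈ S
      · exact ⟨S, Or.inl rfl, by simp [hxS]⟩
      · exact ⟨v \ S, Or.inr rfl, by simp [hxS, hxv]⟩
    · left
      refine ⟨B.singleton_mem x, fun h => hxv ?_⟩
      simpa using h.1
  · intro u
    simp

theorem new_split {B B' : XForest X} {v S : Finset X} (hB : B.Split) (hv : v ∈ B.clusters)
    (hSne : S.Nonempty) (hSv : S ⊂ v)
    (h : ∀ u, u ∈ B'.clusters ↔ NewMem B v S u) : B'.Split := by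
  intro s hs h2
  obtain ⟨hne, hs1 | hs1⟩ := (h s).mp hs
  · by_cases hsv : s = v
    · subst hsv
      refine ⟨S, (h S).mpr ⟨hSne, Or.inr ⟨s, hv, Finset.Subset.refl _, S, Or.inl rfl, ?_⟩⟩,
        s \ S, (h _).mpr ⟨?_, Or.inr ⟨s, hv, Finset.Subset.refl _, s \ S, Or.inr rfl, ?_⟩⟩,
        Finset.disjoint_sdiff, ?_⟩
      · exact (Finset.inter_eq_right.mpr hSv.1).symm
      · exact Finset.sdiff_nonempty.mpr hSv.2
      · exact (Finset.inter_eq_right.mpr Finset.sdiff_subset).symm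
      · exact (Finset.union_sdiff_of_subset hSv.1).symm
    · obtain ⟨a, ha, b, hb, hd, he⟩ := hB s hs1.1 h2
      have key : ∀ a ∈ B.clusters, ∀ b ∈ B.clusters, Disjoint a b → s = a ∪ b → ¬ a ⊂ v := by
        intro a ha b hb hd he hav
        obtain ⟨x, hx⟩ := B.nonempty_of_mem a ha
        have hxs : x ∈ s := by rw [he]; simp [hx]
        have hnsv : ¬ s ⊆ v := by
          intro hh
          by_cases h' : v ⊆ s
          · exact hsv (Finset.Subset.antisymm hh h')
          · exact hs1.2 ⟨hh, h'⟩
        have hvs : v ⊆ s := by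
          rcases B.laminar v hv s hs1.1
            (Finset.not_disjoint_iff.mpr ⟨x, hav.1 hx, hxs⟩) with h | h
          · exact h
          · exact absurd h hnsv
        obtain ⟨y, hyv, hya⟩ := Finset.exists_of_ssubset hav
        have hyb : y ∈ b := by
          have := hvs hyv
          rw [he] at this
          simpa [hya] using this
        rcases B.laminar v hv b hb (Finset.not_disjoint_iff.mpr ⟨y, hyv, hyb⟩) with h | h
        · exact Finset.disjoint_left.mp hd hx (h (hav.1 hx))
        · exact hnsv (he ▸ Finset.union_subset hav.1 h)
      exact ⟨a, (h a).mpr ⟨B.nonempty_of_mem a ha, Or.inl ⟨ha, key a ha b hb hd he⟩⟩,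
        b, (h b).mpr ⟨B.nonempty_of_mem b hb, Or.inl ⟨hb, key b hb a ha hd.symm
          (by rw [he, Finset.union_comm])⟩⟩, hd, he⟩
  · obtain ⟨t, ht, htv, E, hE, hst⟩ := hs1
    have ind : ∀ n : ℕ, ∀ t ∈ B.clusters, t.card ≤ n → t ⊆ v → s = t ∩ E →
        ∃ a ∈ B'.clusters, ∃ b ∈ B'.clusters, Disjoint a b ∧ s = a ∪ b := by
      intro n
      induction n with
      | zero =>
        intro t ht hc htv _
        have := Finset.card_pos.mpr (B.nonempty_of_mem t ht)
        omega
      | succ n ih =>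
        intro t ht hc htv hst
        have ht2 : 2 ≤ t.card := h2.trans (hst ▸ Finset.card_le_card Finset.inter_subset_left)
        obtain ⟨a, ha, b, hb, hd, he⟩ := hB t ht ht2
        have hca := (Split.child_left ht ha hb hd he).2.2.1
        have hcb := (Split.child_left ht hb ha hd.symm (by rw [he, Finset.union_comm])).2.2.1
        have hs' : s = a ∩ E ∪ b ∩ E := by rw [hst, he, Finset.union_inter_distrib_right]
        have hla := Finset.card_lt_card hca
        have hlb := Finset.card_lt_card hcb
        rcases Finset.eq_empty_or_nonempty (a ∩ E) with hae | hae
        · exact ih b hb (by omega) (hcb.1.trans htv) (by rw [hs', hae, Finset.empty_union])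
        · rcases Finset.eq_empty_or_nonempty (b ∩ E) with hbe | hbe
          · exact ih a ha (by omega) (hca.1.trans htv) (by rw [hs', hbe, Finset.union_empty])
          · refine ⟨a ∩ E, (h _).mpr ⟨hae, Or.inr ⟨a, ha, hca.1.trans htv, E, hE, rfl⟩⟩,
              b ∩ E, (h _).mpr ⟨hbe, Or.inr ⟨b, hb, hcb.1.trans htv, E, hE, rfl⟩⟩, ?_, hs'⟩
            exact hd.mono Finset.inter_subset_left Finset.inter_subset_left
    exact ind t.card t ht le_rfl htv hst

theorem new_good {G B B' : XForest X} {v S : Finset X} (hv : v ∈ B.clusters)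
    (h : ∀ u, u ∈ B'.clusters ↔ NewMem B v S u) (hG : Good G B)
    (hno : ∀ l ∈ S, ∀ l' ∈ v \ S, ¬∃ D ∈ G.components, l ∈ D ∧ l' ∈ D) (hSv : S ⊆ v) :
    Good G B' := by
  -- a component meeting `E` stays in `E` inside `v`
  have stay : ∀ E, (E = S ∨ E = v \ S) → ∀ C ∈ G.components, ∀ x ∈ C, x ∈ E →
      ∀ y ∈ C, y ∈ v → y ∈ E := by
    rintro E (rfl | rfl) C hC x hx hxE y hy hyv
    · by_contra hn
      exact hno x hxE y (Finset.mem_sdiff.mpr ⟨hyv, hn⟩) ⟨C, hC, hx, hy⟩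
    · refine Finset.mem_sdiff.mpr ⟨hyv, fun hn => ?_⟩
      exact hno y hn x hxE ⟨C, hC, hy, hx⟩
  have inter : ∀ t, t ⊆ v → ∀ E, (E = S ∨ E = v \ S) → ∀ C ∈ G.components, ∀ x ∈ C, x ∈ E →
      (t ∩ E) ∩ C = t ∩ C := by
    intro t htv E hE C hC x hx hxE
    ext y
    simp only [Finset.mem_inter]
    constructor
    · rintro ⟨⟨h1, -⟩, h2⟩
      exact ⟨h1, h2⟩
    · rintro ⟨h1, h2⟩
      exact ⟨⟨h1, stay E hE C hC x hx hxE y h2 (htv h1)⟩, h2⟩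
  obtain ⟨huniq, hin, hex⟩ := hG
  refine ⟨?_, ?_, ?_⟩
  · intro s hs C hC C' hC' hc hc'
    obtain ⟨-, hs1 | ⟨t, ht, htv, E, hE, rfl⟩⟩ := (h s).mp hs
    · exact huniq s hs1.1 C hC C' hC' hc hc'
    · have up : ∀ C ∈ G.components, Cross C (t ∩ E) → Cross C t := by
        rintro C hC ⟨⟨x, hxC, hx⟩, hn⟩
        rw [Finset.mem_inter] at hx
        refine ⟨⟨x, hxC, hx.1⟩, fun hCt => hn fun y hy => ?_⟩
        exact Finset.mem_inter.mpr ⟨hCt hy, stay E hE C hC x hxC hx.2 y hy (htv (hCt hy))⟩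
      exact huniq t ht C hC C' hC' (up C hC hc) (up C' hC' hc')
  · intro s hs C hC hne
    obtain ⟨-, hs1 | ⟨t, ht, htv, E, hE, rfl⟩⟩ := (h s).mp hs
    · exact hin s hs1.1 C hC hne
    · obtain ⟨x, hx⟩ := hne
      simp only [Finset.mem_inter] at hx
      rw [inter t htv E hE C hC x hx.2 hx.1.2]
      exact hin t ht C hC ⟨x, by simp [hx]⟩
  · intro g hg
    obtain ⟨t, ht, C, hC, hgt⟩ := hex g hg
    by_cases htv : t ⊂ v
    · obtain ⟨x, hx⟩ := G.nonempty_of_mem g hg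
      rw [hgt, Finset.mem_inter] at hx
      obtain ⟨E, hE, hxE⟩ : ∃ E, (E = S ∨ E = v \ S) ∧ x ∈ E := by
        by_cases hxS : x ∈ S
        · exact ⟨S, Or.inl rfl, hxS⟩
        · exact ⟨v \ S, Or.inr rfl, Finset.mem_sdiff.mpr ⟨htv.1 hx.1, hxS⟩⟩
      refine ⟨t ∩ E, (h _).mpr ⟨⟨x, by simp [hx, hxE]⟩, Or.inr ⟨t, ht, htv.1, E, hE, rfl⟩⟩,
        C, hC, ?_⟩
      rw [hgt, inter t htv.1 E hE C hC x hx.2 hxE]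
    · exact ⟨t, (h t).mpr ⟨B.nonempty_of_mem t ht, Or.inl ⟨ht, htv⟩⟩, C, hC, hgt⟩

end aux

end XForest

/-- Lemma 6.1.  Let `F*` be a soft maximum agreement forest
for the forests of an instance `(F_1, …, F_m; k)` of the sMaf problem, let `v`
be a vertex of `F_i` with children `c_1, …, c_q`, and let `F_i'` be obtained
from `F_i` by expanding a children subset `P = {c_1, …, c_p}` (`2 ≤ p < q`),
i.e., by inserting the cluster `L(c_1) ∪ … ∪ L(c_p)`.  If no label of
`L(c_1) ∪ … ∪ L(c_p)` is connected by a path in `F*` to a label of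
`L(c_{p+1}) ∪ … ∪ L(c_q)`, then `F*` is also a soft maximum agreement forest
for the forests of `(F_1, …, F_i', …, F_m; k)`. -/
theorem statement_18 {X : Type*} [DecidableEq X] [Fintype X] {m : ℕ}
    (I : Inst X m) (Fstar : XForest X)
    (hMAF : IsSMAF I.F Fstar)
    (i : Fin m) (v : Finset X) (hv : v ∈ (I.F i).clusters)
    (P : Finset (Finset X)) (hP : ∀ c ∈ P, (I.F i).IsChild c v)
    (hP2 : 2 ≤ P.card)
    (hPlt : ∃ c : Finset X, (I.F i).IsChild c v ∧ c ∉ P)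
    (F' : XForest X) (hF' : F'.clusters = insert (P.biUnion id) (I.F i).clusters)
    (hnopath : ∀ l ∈ P.biUnion id, ∀ l' ∈ v \ P.biUnion id,
      ¬∃ D ∈ Fstar.components, l ∈ D ∧ l' ∈ D) :
    IsSMAF (Function.update I.F i F') Fstar := by
  classical
  set F := I.F i with hF
  set S := P.biUnion id with hS
  -- basic facts on `S`
  have hSmem : ∀ c ∈ P, c ⊆ S := fun c hc => Finset.subset_biUnion_of_mem id hc
  have hSsub : S ⊆ v := by
    intro x hx
    obtain ⟨c, hc, hxc⟩ := Finset.mem_biUnion.mp hx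
    exact (hP c hc).2.2.1.1 hxc
  have hSne : S.Nonempty := by
    obtain ⟨c, hc⟩ : P.Nonempty := Finset.card_pos.mp (by omega)
    obtain ⟨x, hx⟩ := F.nonempty_of_mem c (hP c hc).1
    exact ⟨x, hSmem c hc hx⟩
  have hdisj : ∀ c, F.IsChild c v → c ∉ P → ∀ x ∈ c, x ∉ S := by
    intro c hc hcP x hx hxS
    obtain ⟨d, hd, hxd⟩ := Finset.mem_biUnion.mp hxS
    have hne : c ≠ d := fun h => hcP (h ▸ hd)
    exact Finset.disjoint_left.mp (XForest.child_disj hc (hP d hd) hne) hx hxd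
  have hSv : S ⊂ v := by
    refine ⟨hSsub, fun hvS => ?_⟩
    obtain ⟨c, hc, hcP⟩ := hPlt
    obtain ⟨x, hx⟩ := F.nonempty_of_mem c hc.1
    exact hdisj c hc hcP x hx (hvS (hc.2.2.1.1 hx))
  have hcompF : F'.components = F.components := by
    refine XForest.comps_eq (v := v) (by rw [hF']; exact Finset.mem_insert_of_mem hv) hv ?_
    intro u hu
    rw [hF', Finset.mem_insert]
    constructor
    · rintro (rfl | h)
      · exact absurd hSv hu
      · exact h
    · exact Or.inr
  refine ⟨?_, ?_⟩
  · intro j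
    by_cases hj : j = i
    · subst hj
      rw [Function.update_self]
      obtain ⟨hbin, B, hB, ⟨hFB, hcomp⟩, hsub⟩ := hMAF.1 j
      have hvB : v ∈ B.clusters := hFB hv
      obtain ⟨B', hB'⟩ := XForest.exists_new B (S := S) hvB
      have hvB' : v ∈ B'.clusters :=
        (hB' v).mpr ⟨B.nonempty_of_mem v hvB, Or.inl ⟨hvB, fun h => h.2 (Finset.Subset.refl _)⟩⟩
      have hsp := XForest.new_split hB.split hvB hSne hSv hB'
      have hgood := XForest.new_good hvB hB' hsub.good hnopath hSsub
      refine ⟨hbin, B', hsp.binary, ⟨?_, ?_⟩, hgood.subforest hsp⟩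
      · intro f hf
        rw [hF', Finset.mem_insert] at hf
        rw [hB']
        rcases hf with rfl | hf
        · exact ⟨hSne, Or.inr ⟨v, hvB, Finset.Subset.refl _, S, Or.inl rfl,
            (Finset.inter_eq_right.mpr hSsub).symm⟩⟩
        · refine ⟨XForest.nonempty_of_mem _ f hf, ?_⟩
          by_cases hfv : f ⊂ v
          · right
            obtain ⟨c, hc, hfc⟩ := XForest.exists_child hf hv hfv
            by_cases hcP : c ∈ P
            · exact ⟨f, hFB hf, hfv.1, S, Or.inl rfl,
                (Finset.inter_eq_left.mpr (hfc.trans (hSmem c hcP))).symm⟩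
            · refine ⟨f, hFB hf, hfv.1, v \ S, Or.inr rfl, (Finset.inter_eq_left.mpr ?_).symm⟩
              intro x hx
              exact Finset.mem_sdiff.mpr ⟨hfv.1 hx, hdisj c hc hcP x (hfc hx)⟩
          · exact Or.inl ⟨hFB hf, hfv⟩
      · rw [hcompF, ← hcomp]
        refine XForest.comps_eq hvB' hvB fun u hu => ?_
        rw [hB']
        constructor
        · rintro ⟨-, h | ⟨t, ht, htv, E, hE, rfl⟩⟩
          · exact h.1
          · refine absurd ?_ hu
            have hEv : E ⊂ v := by
              rcases hE with rfl | rfl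
              · exact hSv
              · refine ⟨Finset.sdiff_subset, fun h => ?_⟩
                obtain ⟨x, hx⟩ := hSne
                exact (Finset.mem_sdiff.mp (h (hSsub hx))).2 hx
            exact Finset.ssubset_of_subset_of_ssubset Finset.inter_subset_right hEv
        · intro h
          exact ⟨B.nonempty_of_mem u h, Or.inl ⟨h, hu⟩⟩
    · rw [Function.update_of_ne hj]
      exact hMAF.1 j
  · intro G' hG'
    refine hMAF.2 G' fun j => ?_
    have hj' := hG' j
    by_cases hj : j = i
    · subst hj
      rw [Function.update_self] at hj'
      obtain ⟨hbin, B, hB, ⟨hFB, hcomp⟩, hsub⟩ := hj'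
      refine ⟨hbin, B, hB, ⟨fun f hf => hFB ?_, hcomp.trans hcompF⟩, hsub⟩
      rw [hF']
      exact Finset.mem_insert_of_mem hf
    · rwa [Function.update_of_ne hj] at hj'
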